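/- arXiv:0810.5362 — 2 statements merged into one kernel-verified Lean document; each statement's English description precedes it below -/
import Mathlib

section
/- On the GCM graph of type B_n with n ≥ 2, let (a_1,…,a_n) be a strongly dominant position. Then the concatenated firing sequence (s_n, s_{n−1}, …, s_2), where s_i = (i, i+1, …, n−1, n, n−1, …, i+1, i) for 2 ≤ i ≤ n−1 and s_n = (n), is a legal firing sequence from (a_1,…,a_n), and the resulting position is (a_1 + 2a_2 + ⋯ + 2a_{n−1} + a_n, −a_2, −a_3, …, −a_n); that is, node 1 receives a_1 + a_n + 2·(a_2 + ⋯ + a_{n−1}) and node j receives −a_j for 2 ≤ j ≤ n. -/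
/-- Firing node `i` transforms the position `lam` by `lam j ↦ lam j - M i j * lam i`. -/
def fire (M : ℕ → ℕ → ℤ) (lam : ℕ → ℝ) (i : ℕ) : ℕ → ℝ :=
  fun j => lam j - (M i j : ℝ) * lam i

/-- The position obtained from `lam` by firing the nodes of a list in order. -/
def fireList (M : ℕ → ℕ → ℤ) : (ℕ → ℝ) → List ℕ → (ℕ → ℝ)
  | lam, [] => lam
  | lam, i :: s => fireList M (fire M lam i) s

/-- A list of node firings is legal from `lam` (on the graph with node set `{1,…,n}`)
if each fired node is a node of the graph carrying a positive number at the time of firing. -/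
def LegalSeq (n : ℕ) (M : ℕ → ℕ → ℤ) : (ℕ → ℝ) → List ℕ → Prop
  | _, [] => True
  | lam, i :: s => 1 ≤ i ∧ i ≤ n ∧ 0 < lam i ∧ LegalSeq n M (fire M lam i) s

/-- The GCM of type `A n` on nodes `{1,…,n}` (extended by zero off the node set). -/
def MtypeA (n : ℕ) : ℕ → ℕ → ℤ := fun i j =>
  if i = j then 2
  else if 1 ≤ i ∧ i ≤ n ∧ 1 ≤ j ∧ j ≤ n ∧ (i + 1 = j ∨ j + 1 = i) then -1
  else 0

/-- The GCM of type `B n` on nodes `{1,…,n}`: as type `A n` except `M (n-1) n = -2`. -/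
def MtypeB (n : ℕ) : ℕ → ℕ → ℤ := fun i j =>
  if i = j then 2
  else if 1 ≤ i ∧ i + 1 = j ∧ j ≤ n then (if j = n then -2 else -1)
  else if 1 ≤ j ∧ j + 1 = i ∧ i ≤ n then -1
  else 0

/-- The GCM of type `C n` on nodes `{1,…,n}`: as type `A n` except `M n (n-1) = -2`. -/
def MtypeC (n : ℕ) : ℕ → ℕ → ℤ := fun i j =>
  if i = j then 2
  else if 1 ≤ i ∧ i + 1 = j ∧ j ≤ n then -1
  else if 1 ≤ j ∧ j + 1 = i ∧ i ≤ n then (if i = n then -2 else -1)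
  else 0

/-- The GCM of type `D n` on nodes `{1,…,n}`: a path `1,…,n-1` together with the
edge `{n-2, n}`, all amplitudes `-1`. -/
def MtypeD (n : ℕ) : ℕ → ℕ → ℤ := fun i j =>
  if i = j then 2
  else if (1 ≤ i ∧ i + 1 = j ∧ j ≤ n - 1) ∨ (1 ≤ j ∧ j + 1 = i ∧ i ≤ n - 1) then -1
  else if (i = n - 2 ∧ j = n) ∨ (j = n - 2 ∧ i = n) then -1
  else 0

/-- The firing sequence `(s_n, s_{n-1}, …, s_2)` of Lemma 2.1.B, where
`s_i = (i, i+1, …, n-1, n, n-1, …, i+1, i)` for `2 ≤ i ≤ n-1` and `s_n = (n)`. -/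
def seqBC2 (n : ℕ) : List ℕ :=
  ((List.range' 2 (n - 1)).reverse).flatMap fun i =>
    List.range' i (n + 1 - i) ++ (List.range' i (n - i)).reverse

theorem fireList_append (M : ℕ → ℕ → ℤ) (lam : ℕ → ℝ) (s t : List ℕ) :
    fireList M lam (s ++ t) = fireList M (fireList M lam s) t := by
  induction s generalizing lam with
  | nil => rfl
  | cons i s ih => exact ih _

theorem legalSeq_append (n : ℕ) (M : ℕ → ℕ → ℤ) (lam : ℕ → ℝ) (s t : List ℕ) :
    LegalSeq n M lam (s ++ t) ↔ LegalSeq n M lam s ∧ LegalSeq n M (fireList M lam s) t := by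
  induction s generalizing lam with
  | nil => simp [LegalSeq, fireList]
  | cons i s ih => simp [LegalSeq, fireList, ih, and_assoc]

/-- The position `lam` on `B n` has orthogonal coordinates `x`: the simple coroots take the values
`x j - x (j + 1)` for `j < n` and `2 * x n`. -/
def HasCoords (n : ℕ) (x lam : ℕ → ℝ) : Prop :=
  ∀ j, 1 ≤ j → j ≤ n → lam j = if j = n then 2 * x n else x j - x (j + 1)

theorem HasCoords.congr {n : ℕ} {x y lam : ℕ → ℝ} (h : HasCoords n x lam)
    (hxy : ∀ j, 1 ≤ j → j ≤ n → x j = y j) : HasCoords n y lam := by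
  intro j h1 hj
  rw [h j h1 hj]
  split_ifs with hjn
  · rw [hxy n (by omega) le_rfl]
  · rw [hxy j h1 hj, hxy (j + 1) (by omega) (by omega)]

/-- Firing a node `i < n` swaps the coordinates `i` and `i + 1`. -/
theorem HasCoords.fire_swap {n i : ℕ} {x lam : ℕ → ℝ} (h : HasCoords n x lam)
    (h1 : 1 ≤ i) (hi : i < n) :
    HasCoords n (fun j => x (Equiv.swap i (i + 1) j)) (fire (MtypeB n) lam i) := by
  intro j hj1 hj
  simp only [fire, h j hj1 hj, h i h1 hi.le, if_neg hi.ne, MtypeB, Equiv.swap_apply_def]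
  split_ifs <;> first | omega | skip
  all_goals subst_vars
  all_goals push_cast
  all_goals try ring

/-- Firing the node `n` negates the coordinate `n`. -/
theorem HasCoords.fire_neg {n : ℕ} {x lam : ℕ → ℝ} (h : HasCoords n x lam) (h1 : 1 ≤ n) :
    HasCoords n (Function.update x n (-x n)) (fire (MtypeB n) lam n) := by
  intro j hj1 hj
  simp only [fire, h j hj1 hj, h n h1 le_rfl, if_true, MtypeB, Function.update_apply]
  split_ifs <;> first | omega | skip
  all_goals subst_vars
  all_goals push_cast
  all_goals try ring

/-- If `x i` is positive and strictly dominates all later coordinates in absolute value, then the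
sequence `(i, …, n - 1, n, n - 1, …, i)` is legal and negates the coordinate `i`. -/
theorem HasCoords.fireList_block {n : ℕ} (d : ℕ) {i : ℕ} {x lam : ℕ → ℝ} (h : HasCoords n x lam)
    (h1 : 1 ≤ i) (hd : i + d = n) (hpos : 0 < x i) (hdom : ∀ j, i < j → j ≤ n → |x j| < x i) :
    LegalSeq n (MtypeB n) lam (List.range' i (d + 1) ++ (List.range' i d).reverse) ∧
    HasCoords n (Function.update x i (-x i))
      (fireList (MtypeB n) lam (List.range' i (d + 1) ++ (List.range' i d).reverse)) := by
  induction d generalizing i x lam with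
  | zero =>
    obtain rfl : i = n := by omega
    have hlam : 0 < lam i := by rw [h i h1 le_rfl, if_pos rfl]; linarith
    simpa [LegalSeq, fireList, h1, hlam] using h.fire_neg h1
  | succ d ih =>
    have hin : i < n := by omega
    obtain ⟨hlt1, hlt2⟩ := abs_lt.1 (hdom (i + 1) (by omega) (by omega))
    have hlam : 0 < lam i := by rw [h i h1 hin.le, if_neg hin.ne]; linarith
    obtain ⟨hleg, hco⟩ := ih (h.fire_swap h1 hin) (i := i + 1) (by omega) (by omega)
      (by simpa using hpos) (by
        intro j hj hjn
        simpa [Equiv.swap_apply_of_ne_of_ne (show j ≠ i by omega) (show j ≠ i + 1 by omega)]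
          using hdom j (by omega) hjn)
    have hseq : List.range' i (d + 1 + 1) ++ (List.range' i (d + 1)).reverse =
        i :: ((List.range' (i + 1) (d + 1) ++ (List.range' (i + 1) d).reverse) ++ [i]) := by
      rw [List.range'_succ (n := d + 1), List.range'_succ (s := i) (n := d)]
      simp
    rw [hseq, ← List.cons_append, legalSeq_append, fireList_append]
    refine ⟨⟨⟨h1, hin.le, hlam, hleg⟩, h1, hin.le, ?_, trivial⟩, ?_⟩
    · refine lt_of_lt_of_eq ?_ (hco i h1 hin.le).symm
      simp [hin.ne]
      linarith
    · refine (hco.fire_swap h1 hin).congr fun j _ _ => ?_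
      rcases eq_or_ne j i with rfl | hji
      · simp
      rcases eq_or_ne j (i + 1) with rfl | hji'
      · simp
      · simp [Equiv.swap_apply_of_ne_of_ne hji hji', hji, hji']

/-- For positive coordinates that are strictly decreasing in absolute value, firing the blocks
starting at `n, n - 1, …, k` in turn is legal and negates the coordinates `k, …, n`. -/
theorem HasCoords.fireList_blocks {n : ℕ} (d : ℕ) {k : ℕ} {x lam : ℕ → ℝ} (h : HasCoords n x lam)
    (h1 : 1 ≤ k) (hd : k + d = n + 1) (hpos : ∀ i, 1 ≤ i → i ≤ n → 0 < x i)
    (hdom : ∀ i j, 1 ≤ i → i < j → j ≤ n → |x j| < x i) :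
    LegalSeq n (MtypeB n) lam (((List.range' k d).reverse).flatMap fun i =>
      List.range' i (n + 1 - i) ++ (List.range' i (n - i)).reverse) ∧
    HasCoords n (fun j => if k ≤ j then -x j else x j)
      (fireList (MtypeB n) lam (((List.range' k d).reverse).flatMap fun i =>
        List.range' i (n + 1 - i) ++ (List.range' i (n - i)).reverse)) := by
  induction d generalizing k with
  | zero =>
    refine ⟨trivial, h.congr fun j _ hj => ?_⟩
    rw [if_neg (by omega)]
  | succ d ih =>
    obtain ⟨hleg, hco⟩ := ih (k := k + 1) (by omega) (by omega)
    obtain ⟨hleg', hco'⟩ := hco.fireList_block (n - k) h1 (by omega)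
      (by simpa using hpos k h1 (by omega)) (by
        intro j hj hjn
        rw [if_pos (by omega), if_neg (by omega), abs_neg]
        exact hdom k j h1 hj hjn)
    rw [List.range'_succ, List.reverse_cons, List.flatMap_append, legalSeq_append,
      fireList_append, List.flatMap_singleton, show n + 1 - k = n - k + 1 by omega]
    refine ⟨⟨hleg, hleg'⟩, hco'.congr fun j _ _ => ?_⟩
    rcases lt_trichotomy j k with hj | rfl | hj
    · simp [hj.ne, hj.not_ge, hj.not_gt]
    · simp
    · simp [hj.ne', hj.le, hj]

/-- On type `B n` (`n ≥ 2`), from a strongly dominant position `(a 1, …, a n)` the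
firing sequence `(s_n, …, s_2)` is legal and yields the position
`(a 1 + 2 a 2 + ⋯ + 2 a (n-1) + a n, -a 2, -a 3, …, -a n)`. -/
theorem typeB_from2 (n : ℕ) (hn : 2 ≤ n) (a : ℕ → ℝ)
    (ha : ∀ i, 1 ≤ i → i ≤ n → 0 < a i) :
    LegalSeq n (MtypeB n) a (seqBC2 n) ∧
    fireList (MtypeB n) a (seqBC2 n) 1
      = a 1 + a n + 2 * ∑ k ∈ Finset.Icc 2 (n - 1), a k ∧
    ∀ j, 2 ≤ j → j ≤ n → fireList (MtypeB n) a (seqBC2 n) j = -(a j) := by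
  set x : ℕ → ℝ := fun j => ∑ k ∈ Finset.Ico j n, a k + a n / 2 with hx
  have hstep : ∀ j, j < n → x j = a j + x (j + 1) := by
    intro j hj
    simp only [hx, Finset.sum_eq_sum_Ico_succ_bot hj]
    ring
  have hxn : x n = a n / 2 := by simp [hx]
  have han := ha n (by omega) le_rfl
  have hpos : ∀ i, 1 ≤ i → i ≤ n → 0 < x i := by
    intro i hi _
    have : 0 ≤ ∑ k ∈ Finset.Ico i n, a k := Finset.sum_nonneg fun k hk => by
      rw [Finset.mem_Ico] at hk
      exact (ha k (by omega) (by omega)).le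
    simp only [hx]
    linarith
  have hdom : ∀ i j, 1 ≤ i → i < j → j ≤ n → |x j| < x i := by
    intro i j hi hij hj
    rw [abs_of_pos (hpos j (by omega) hj)]
    induction j, hij using Nat.le_induction with
    | base => linarith [hstep i (by omega), ha i hi (by omega)]
    | succ j hij ih => linarith [hstep j (by omega), ha j (by omega) (by omega), ih (by omega)]
  have h : HasCoords n x a := by
    intro j _ hj
    split_ifs with hjn
    · rw [hxn, hjn]; ring
    · rw [hstep j (by omega)]; ring
  obtain ⟨hleg, hco⟩ := h.fireList_blocks (n - 1) (k := 2) (by omega) (by omega) hpos hdom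
  refine ⟨hleg, ?_, fun j hj hjn => ?_⟩
  · have hx2 : x 2 = ∑ k ∈ Finset.Icc 2 (n - 1), a k + a n / 2 := by
      rw [show Finset.Icc 2 (n - 1) = Finset.Ico 2 n by
        ext k
        simp only [Finset.mem_Icc, Finset.mem_Ico]
        omega]
    refine (hco 1 le_rfl (by omega)).trans ?_
    rw [if_neg (by omega)]
    simp only [Nat.reduceAdd, Nat.reduceLeDiff, if_true, if_false]
    rw [hstep 1 (by omega), hx2]
    ring
  · refine (hco j (by omega) hjn).trans ?_
    simp only [if_pos hj, if_pos hn, if_pos (show 2 ≤ j + 1 by omega)]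
    split_ifs with hjn'
    · rw [hxn, hjn']; ring
    · rw [hstep j (by omega)]; ring
end

section
/- On the GCM graph of type B_n with n ≥ 2, let (a_1,…,a_n) be a strongly dominant position. Then the concatenated firing sequence (s_n, s_{n−1}, …, s_1), where s_i = (i, i+1, …, n−1, n, n−1, …, i+1, i) for 1 ≤ i ≤ n−1 and s_n = (n), is a legal firing sequence from (a_1,…,a_n), and the resulting position is (−a_1, −a_2, …, −a_n). -/
/-- The firing sequence `(s_n, s_{n-1}, …, s_1)` of Lemma 2.2.B, where
`s_i = (i, i+1, …, n-1, n, n-1, …, i+1, i)` for `1 ≤ i ≤ n-1` and `s_n = (n)`. -/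
def seqBC1 (n : ℕ) : List ℕ :=
  ((List.range' 1 n).reverse).flatMap fun i =>
    List.range' i (n + 1 - i) ++ (List.range' i (n - i)).reverse

theorem LegalSeq.append {n : ℕ} {M : ℕ → ℕ → ℤ} {lam : ℕ → ℝ} {s t : List ℕ}
    (hs : LegalSeq n M lam s) (ht : LegalSeq n M (fireList M lam s) t) :
    LegalSeq n M lam (s ++ t) := by
  induction s generalizing lam with
  | nil => exact ht
  | cons i s ih =>
    obtain ⟨h1, h2, h3, h4⟩ := hs
    exact ⟨h1, h2, h3, ih h4 ht⟩

/-- The list `s` is a legal firing sequence from `lam` on `B n`, ending at `mu`. -/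
def LegalPathB (n : ℕ) (lam : ℕ → ℝ) (s : List ℕ) (mu : ℕ → ℝ) : Prop :=
  LegalSeq n (MtypeB n) lam s ∧ fireList (MtypeB n) lam s = mu

theorem LegalPathB.append {n : ℕ} {lam mu nu : ℕ → ℝ} {s t : List ℕ}
    (hs : LegalPathB n lam s mu) (ht : LegalPathB n mu t nu) :
    LegalPathB n lam (s ++ t) nu := by
  obtain ⟨hs, rfl⟩ := hs
  exact ⟨hs.append ht.1, by rw [fireList_append, ht.2]⟩

theorem LegalPathB.singleton {n i : ℕ} {lam mu : ℕ → ℝ} (h1 : 1 ≤ i) (hin : i ≤ n)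
    (hpos : 0 < lam i) (h : fire (MtypeB n) lam i = mu) : LegalPathB n lam [i] mu :=
  ⟨⟨h1, hin, hpos, trivial⟩, h⟩

/-- The position on `B n` with orthogonal coordinates `x 1, …, x n`: node `j < n` carries
`x j - x (j + 1)` and node `n` carries `2 * x n`. Off the graph it agrees with `a`. -/
def posB (n : ℕ) (a x : ℕ → ℝ) : ℕ → ℝ := fun j =>
  if j = n then 2 * x n else if 1 ≤ j ∧ j < n then x j - x (j + 1) else a j

theorem posB_congr {n : ℕ} (a : ℕ → ℝ) {x y : ℕ → ℝ} (hn : 1 ≤ n)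
    (h : ∀ j, 1 ≤ j → j ≤ n → x j = y j) : posB n a x = posB n a y := by
  funext j
  unfold posB
  split_ifs with h1 h2
  · rw [h n hn le_rfl]
  · rw [h j h2.1 h2.2.le, h (j + 1) (by omega) (by omega)]
  · rfl

theorem fire_posB_last {n : ℕ} (hn : 1 ≤ n) (a x : ℕ → ℝ) :
    fire (MtypeB n) (posB n a x) n = posB n a (Function.update x n (-x n)) := by
  funext j
  simp only [fire, posB, MtypeB, Function.update_apply]
  split_ifs <;> first | omega | (subst_vars; push_cast; ring1)

theorem fire_posB_of_lt {n i : ℕ} (h1 : 1 ≤ i) (hi : i < n) (a x : ℕ → ℝ) :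
    fire (MtypeB n) (posB n a x) i = posB n a (fun j => x (Equiv.swap i (i + 1) j)) := by
  funext j
  simp only [fire, posB, MtypeB, Equiv.swap_apply_def]
  split_ifs <;> first | omega | (subst_vars; push_cast; ring1)

/-- The sequence `(i, …, n, …, i)`, where `n = i + d`, negates the coordinate `x i` when it
strictly dominates the later ones. -/
theorem legalPathB_block (n : ℕ) (a : ℕ → ℝ) (d : ℕ) : ∀ (i : ℕ) (x : ℕ → ℝ), 1 ≤ i → i + d = n →
    0 < x i → (∀ j, i < j → j ≤ n → |x j| < x i) →
    LegalPathB n (posB n a x) (List.range' i (d + 1) ++ (List.range' i d).reverse)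
      (posB n a (Function.update x i (-x i))) := by
  induction d with
  | zero =>
    rintro i x h1 rfl h0 -
    exact .singleton h1 (by simp) (by simpa [posB] using h0) (fire_posB_last h1 a x)
  | succ d ih =>
    intro i x h1 hd h0 hx
    have hin : i < n := by omega
    have hlt := abs_lt.1 (hx (i + 1) (by omega) (by omega))
    have hlist : List.range' i (d + 1 + 1) ++ (List.range' i (d + 1)).reverse =
        [i] ++ ((List.range' (i + 1) (d + 1) ++ (List.range' (i + 1) d).reverse) ++ [i]) := by
      rw [List.range'_succ (s := i) (n := d + 1), List.range'_succ (s := i) (n := d)]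
      simp
    rw [hlist]
    refine .append (.singleton h1 hin.le ?_ (fire_posB_of_lt h1 hin a x))
      (.append (ih (i + 1) _ (by omega) (by omega) ?_ ?_) (.singleton h1 hin.le ?_ ?_))
    · simp only [posB, if_neg hin.ne, if_pos (And.intro h1 hin)]
      linarith
    · simpa using h0
    · intro j hj hjn
      rw [Equiv.swap_apply_right, Equiv.swap_apply_of_ne_of_ne (by omega) (by omega)]
      exact hx j (by omega) hjn
    · simp only [posB, if_neg hin.ne, if_pos (And.intro h1 hin)]
      simp
      linarith
    · rw [fire_posB_of_lt h1 hin]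
      refine posB_congr a (by omega) fun j _ _ => ?_
      simp only [Function.update_apply, Equiv.swap_apply_def]
      grind

theorem legalPathB_blocks {n : ℕ} (hn : 1 ≤ n) (a x : ℕ → ℝ) (h0 : ∀ j, 1 ≤ j → j ≤ n → 0 < x j)
    (hx : ∀ i j, 1 ≤ i → i < j → j ≤ n → x j < x i) (m : ℕ) : ∀ i, 1 ≤ i → i + m = n + 1 →
    LegalPathB n (posB n a x)
      ((List.range' i m).reverse.flatMap fun i =>
        List.range' i (n + 1 - i) ++ (List.range' i (n - i)).reverse)
      (posB n a fun j => if i ≤ j then -x j else x j) := by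
  induction m with
  | zero =>
    intro i h1 hi
    exact ⟨trivial, posB_congr a hn fun j _ _ => (if_neg (by omega)).symm⟩
  | succ m ih =>
    intro i h1 hi
    rw [List.range'_succ, List.reverse_cons, List.flatMap_append]
    refine (ih (i + 1) (by omega) (by omega)).append ?_
    have hb := legalPathB_block n a (n - i) i (fun j => if i + 1 ≤ j then -x j else x j) h1
      (by omega) (by simpa using h0 i h1 (by omega)) fun j hj hjn => by
        simp only [if_pos (Nat.succ_le_of_lt hj), Nat.not_succ_le_self, if_false, abs_neg]
        rw [abs_of_pos (h0 j (by omega) hjn)]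
        exact hx i j h1 hj hjn
    rw [show n - i + 1 = n + 1 - i by omega] at hb
    convert hb using 1
    · simp
    · refine posB_congr a (by omega) fun j _ _ => ?_
      simp only [Function.update_apply]
      grind

/-- On type `B n` (`n ≥ 2`), from a strongly dominant position `(a 1, …, a n)` the
firing sequence `(s_n, …, s_1)` is legal and yields `(-a 1, -a 2, …, -a n)`. -/
theorem typeB_from1 (n : ℕ) (hn : 2 ≤ n) (a : ℕ → ℝ)
    (ha : ∀ i, 1 ≤ i → i ≤ n → 0 < a i) :
    LegalSeq n (MtypeB n) a (seqBC1 n) ∧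
    ∀ j, 1 ≤ j → j ≤ n → fireList (MtypeB n) a (seqBC1 n) j = -(a j) := by
  let x : ℕ → ℝ := fun j => ∑ k ∈ Finset.Ico j n, a k + a n / 2
  have hlast : x n = a n / 2 := by simp [x]
  have hstep : ∀ j, j < n → x j = a j + x (j + 1) := fun j hj => by
    simp only [x, Finset.sum_eq_sum_Ico_succ_bot hj, add_assoc]
  have hpos : ∀ j, 1 ≤ j → j ≤ n → 0 < x j := fun j h1 _ =>
    add_pos_of_nonneg_of_pos
      (Finset.sum_nonneg fun k hk => by
        rw [Finset.mem_Ico] at hk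
        exact (ha k (by omega) hk.2.le).le)
      (half_pos (ha n (by omega) le_rfl))
  have hanti : ∀ i j, 1 ≤ i → i < j → j ≤ n → x j < x i := fun i j h1 hij => by
    induction j, hij using Nat.le_induction with
    | base => intro h; linarith [hstep i h, ha i h1 (by omega)]
    | succ j hj ih =>
      intro h
      linarith [ih (by omega), hstep j h, ha j (by omega) (by omega)]
  have hax : posB n a x = a := by
    funext j
    unfold posB
    split_ifs with h1 h2
    · rw [hlast, h1]; ring
    · rw [hstep j h2.2]; ring
    · rfl
  obtain ⟨hlegal, hfire⟩ := legalPathB_blocks (by omega) a x hpos hanti n 1 le_rfl (by omega)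
  rw [hax] at hlegal hfire
  refine ⟨hlegal, fun j h1 hj => ?_⟩
  rw [seqBC1, hfire]
  simp only [posB, if_pos h1, if_pos (h1.trans hj), if_pos (Nat.le_add_left 1 j)]
  split_ifs with hjn hlt
  · rw [hlast, hjn]; ring
  · rw [hstep j hlt.2]; ring
  · omega
end
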